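/- arXiv:2404.10951 — 5 statements merged into one kernel-verified Lean document; each statement's English description precedes it below -/
import Mathlib

section
/- There exist constants 0 < c₁ ≤ c₂ (depending on n, k, κ) and R₀ ≥ 1 (depending on n, k, κ) such that for all R ≥ R₀ the Lebesgue measure of Λ in ℝ^{n+1} satisfies c₁ · R^{(n+1+k)/2 − κ(k+1)} ≤ |Λ| ≤ c₂ · R^{(n+1+k)/2 − κ(k+1)}. -/
open MeasureTheory Metric

/-- The set
`Λ := [B^{n+1-k}(0, cR^{1/2}) × (R^κ ℤ^{k-1} + B^{k-1}(0,c)) × ((1/(2π))R^{2κ}ℤ + (-c,c))] ∩ B^{n+1}(0,R)`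
in `ℝ^{n+1}`, with `c = 1/1000`, where the coordinates are split as
`x = (x', x'', x_{n+1}) ∈ ℝ^{n+1-k} × ℝ^{k-1} × ℝ`. -/
noncomputable def Lambda (n k : ℕ) (κ R : ℝ) : Set (EuclideanSpace ℝ (Fin (n + 1))) :=
  {x : EuclideanSpace ℝ (Fin (n + 1)) |
      (∑ i : Fin (n + 1), if (i : ℕ) < n + 1 - k then x i ^ 2 else 0)
          < ((1 / 1000 : ℝ) * R ^ ((1 : ℝ) / 2)) ^ 2 ∧
      (∃ a : Fin (n + 1) → ℤ,
        (∀ i : Fin (n + 1), ¬(n + 1 - k ≤ (i : ℕ) ∧ (i : ℕ) < n) → a i = 0) ∧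
        (∑ i : Fin (n + 1), if n + 1 - k ≤ (i : ℕ) ∧ (i : ℕ) < n
            then (x i - R ^ κ * a i) ^ 2 else 0)
          < ((1 / 1000 : ℝ)) ^ 2) ∧
      (∃ j : ℤ, |x (Fin.last n) - 1 / (2 * Real.pi) * R ^ (2 * κ) * j| < (1 / 1000 : ℝ))} ∩
    ball (0 : EuclideanSpace ℝ (Fin (n + 1))) R

/-- The points of `(-M, M)` at distance less than `r` from the lattice `dℤ`. -/
def latticeNeighborhood (d r M : ℝ) : Set ℝ := {t | |t| < M ∧ ∃ a : ℤ, |t - d * a| < r}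

theorem le_volume_latticeNeighborhood {d r M : ℝ} (hr : 0 < r) (hd : 2 * r ≤ d) (hM : d ≤ M) :
    ENNReal.ofReal (r * (M / d)) ≤ volume (latticeNeighborhood d r M) := by
  have hd0 : 0 < d := by linarith
  have hx : 1 ≤ M / d := by rwa [le_div_iff₀ hd0, one_mul]
  set N := ⌊M / d⌋₊ with hN
  have hN1 : (1 : ℝ) ≤ N := by exact_mod_cast Nat.le_floor (by exact_mod_cast hx)
  have hN2 : M / d < N + 1 := Nat.lt_floor_add_one _
  have hN3 : (N : ℝ) * d ≤ M := by
    rw [← le_div_iff₀ hd0]; exact Nat.floor_le (by linarith)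
  have hsub : (⋃ a ∈ Finset.range N, ball (d * (a : ℝ)) r) ⊆ latticeNeighborhood d r M := by
    intro t ht
    simp only [Set.mem_iUnion, Finset.mem_range, mem_ball, Real.dist_eq, exists_prop] at ht
    obtain ⟨a, ha, hta⟩ := ht
    refine ⟨?_, a, by simpa using hta⟩
    have ha1 : (a : ℝ) + 1 ≤ N := by exact_mod_cast ha
    have ha0 : 0 ≤ d * (a : ℝ) := by positivity
    have ha2 : ((a : ℝ) + 1) * d ≤ N * d := by gcongr
    rw [abs_lt] at hta ⊢
    constructor <;> linarith
  refine le_trans ?_ (measure_mono hsub)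
  rw [measure_biUnion_finset]
  · simp only [Real.volume_ball, Finset.sum_const, Finset.card_range, nsmul_eq_mul]
    rw [← ENNReal.ofReal_natCast, ← ENNReal.ofReal_mul (by positivity)]
    apply ENNReal.ofReal_le_ofReal
    nlinarith
  · intro a _ b _ hab
    apply ball_disjoint_ball
    rw [Real.dist_eq, ← mul_sub, abs_mul, abs_of_pos hd0]
    have h1 : (1 : ℝ) ≤ |(a : ℝ) - b| := by
      have : (1 : ℤ) ≤ |(a : ℤ) - b| := Int.one_le_abs (sub_ne_zero.2 (by exact_mod_cast hab))
      exact_mod_cast this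
    nlinarith
  · intro a _
    exact measurableSet_ball

theorem volume_latticeNeighborhood_le {d r M : ℝ} (hr : 0 < r) (hd : 2 * r ≤ d) (hM : d ≤ M) :
    volume (latticeNeighborhood d r M) ≤ ENNReal.ofReal (14 * r * (M / d)) := by
  have hd0 : 0 < d := by linarith
  have hx : 1 ≤ M / d := by rwa [le_div_iff₀ hd0, one_mul]
  set N := ⌈2 * (M / d)⌉₊ with hN
  have hN1 : (N : ℝ) < 2 * (M / d) + 1 := Nat.ceil_lt_add_one (by positivity)
  have hN2 : 2 * (M / d) ≤ N := Nat.le_ceil _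
  have hsub : latticeNeighborhood d r M ⊆
      ⋃ a ∈ Finset.Icc (-(N : ℤ)) N, ball (d * (a : ℝ)) r := by
    rintro t ⟨ht, a, hta⟩
    simp only [Set.mem_iUnion, mem_ball, Real.dist_eq, exists_prop]
    refine ⟨a, ?_, hta⟩
    have h1 : |d * (a : ℝ)| < 2 * M := by
      have := abs_sub_abs_le_abs_sub (d * (a : ℝ)) t
      rw [abs_sub_comm] at this
      linarith
    have h2 : |(a : ℝ)| ≤ N := by
      rw [abs_mul, abs_of_pos hd0] at h1
      refine le_trans ?_ hN2
      rw [← mul_div_assoc, le_div_iff₀ hd0]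
      linarith
    have h3 : |a| ≤ (N : ℤ) := by exact_mod_cast h2
    rw [Finset.mem_Icc]
    exact abs_le.1 h3
  refine (measure_mono hsub).trans ((measure_biUnion_finset_le _ _).trans ?_)
  simp only [Real.volume_ball, Finset.sum_const, nsmul_eq_mul]
  rw [← ENNReal.ofReal_natCast, ← ENNReal.ofReal_mul (by positivity)]
  apply ENNReal.ofReal_le_ofReal
  have hcard : (((Finset.Icc (-(N : ℤ)) N).card : ℕ) : ℝ) = 2 * N + 1 := by
    have : (((Finset.Icc (-(N : ℤ)) N).card : ℕ) : ℤ) = 2 * N + 1 := by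
      rw [Int.card_Icc]; omega
    exact_mod_cast this
  rw [hcard]
  nlinarith

theorem volume_euclidean_box {ι : Type*} [Fintype ι] (A : ι → Set ℝ) :
    volume {x : EuclideanSpace ℝ ι | ∀ i, x i ∈ A i} = ∏ i, volume (A i) := by
  rw [← volume_pi_pi,
    ← (EuclideanSpace.volume_preserving_symm_measurableEquiv_toLp ι).measure_preimage_equiv]
  congr 1
  ext x
  simp

/-- A box in `ℝ^{n+1}` adapted to the splitting `ℝ^m × ℝ^{n-m} × ℝ`: an interval of radius
`ρ` in the first factor, lattice neighbourhoods in the other two. -/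
def latticeBox (n m : ℕ) (ρ d d' r M : ℝ) (i : Fin (n + 1)) : Set ℝ :=
  if (i : ℕ) < m then ball 0 ρ
  else if (i : ℕ) < n then latticeNeighborhood d r M
  else latticeNeighborhood d' r M

/-- The power of `R` to which the side of `Lambda` in the `i`-th direction is comparable. -/
noncomputable def sideExponent (n m : ℕ) (κ : ℝ) (i : Fin (n + 1)) : ℝ :=
  if (i : ℕ) < m then 1 / 2 else if (i : ℕ) < n then 1 - κ else 1 - 2 * κ

theorem sum_sideExponent (m l : ℕ) (κ : ℝ) :
    ∑ i, sideExponent (m + l) m κ i = m / 2 + l * (1 - κ) + (1 - 2 * κ) := by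
  rw [Fin.sum_univ_castSucc, Fin.sum_univ_add]
  simp [sideExponent]
  ring

theorem Lambda_subset_box (n k : ℕ) {κ R : ℝ} (hR : 0 < R) :
    Lambda n k κ R ⊆ {x | ∀ i, x i ∈ latticeBox n (n + 1 - k) (1 / 1000 * R ^ (1 / 2 : ℝ))
      (R ^ κ) (1 / (2 * Real.pi) * R ^ (2 * κ)) (1 / 1000) R i} := by
  rintro x ⟨⟨h1, ⟨a, -, h2⟩, j, h3⟩, h4⟩ i
  have hxi : |x i| < R := by
    rw [mem_ball_zero_iff] at h4
    exact (PiLp.norm_apply_le x i).trans_lt h4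
  unfold latticeBox
  split_ifs with hi hi'
  · rw [mem_ball_zero_iff, Real.norm_eq_abs]
    refine abs_lt_of_sq_lt_sq (lt_of_le_of_lt ?_ h1) (by positivity)
    refine le_trans (by simp [hi]) (Finset.single_le_sum (f := fun i : Fin (n + 1) =>
      if (i : ℕ) < n + 1 - k then x i ^ 2 else 0) (fun i _ => ?_) (Finset.mem_univ i))
    dsimp only; split_ifs <;> positivity
  · refine ⟨hxi, a i, abs_lt_of_sq_lt_sq (lt_of_le_of_lt ?_ h2) (by positivity)⟩
    refine le_trans (by simp [hi', not_lt.1 hi]) (Finset.single_le_sum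
      (f := fun i : Fin (n + 1) => if n + 1 - k ≤ (i : ℕ) ∧ (i : ℕ) < n
        then (x i - R ^ κ * a i) ^ 2 else 0) (fun i _ => ?_) (Finset.mem_univ i))
    dsimp only; split_ifs <;> positivity
  · obtain rfl : i = Fin.last n := Fin.ext (by simp; omega)
    exact ⟨hxi, j, h3⟩

theorem box_subset_Lambda (n k : ℕ) (hk2 : 2 ≤ k) {κ R : ℝ} (hR : 1 ≤ R) :
    {x | ∀ i, x i ∈ latticeBox n (n + 1 - k) (1 / (1000 * (n + 1)) * R ^ (1 / 2 : ℝ))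
      (R ^ κ) (1 / (2 * Real.pi) * R ^ (2 * κ)) (1 / (1000 * (n + 1))) (R / (n + 1)) i}
      ⊆ Lambda n k κ R := by
  intro x hx
  simp only [Set.mem_ofPred_eq, latticeBox] at hx
  have hR0 : 0 < R := by linarith
  have hsum : ∀ (f : Fin (n + 1) → ℝ) (b : ℝ), 0 < b →
      (∀ i, f i < (b / (n + 1)) ^ 2) → ∑ i, f i < b ^ 2 := by
    intro f b hb hf
    calc ∑ i, f i < ∑ i : Fin (n + 1), (b / (n + 1)) ^ 2 :=
          Finset.sum_lt_sum_of_nonempty Finset.univ_nonempty fun i _ => hf i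
      _ = b ^ 2 / (n + 1) := by
          simp only [Finset.sum_const, Finset.card_univ, Fintype.card_fin, nsmul_eq_mul]
          push_cast; field_simp
      _ ≤ b ^ 2 := div_le_self (by positivity) (by linarith [Nat.cast_nonneg (α := ℝ) n])
  have hsq : ∀ {u v : ℝ}, |u| < v → u ^ 2 < v ^ 2 := fun h =>
    sq_lt_sq' (abs_lt.1 h).1 (abs_lt.1 h).2
  have hmid : ∀ i : Fin (n + 1), ∃ a : ℤ, (¬(n + 1 - k ≤ (i : ℕ) ∧ (i : ℕ) < n) → a = 0) ∧
      ((n + 1 - k ≤ (i : ℕ) ∧ (i : ℕ) < n) → |x i - R ^ κ * a| < 1 / (1000 * (n + 1))) := by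
    intro i
    by_cases hi : n + 1 - k ≤ (i : ℕ) ∧ (i : ℕ) < n
    · have := hx i
      rw [if_neg (not_lt.2 hi.1), if_pos hi.2] at this
      obtain ⟨-, a, ha⟩ := this
      exact ⟨a, fun h => absurd hi h, fun _ => ha⟩
    · exact ⟨0, fun _ => rfl, fun h => absurd h hi⟩
  choose a ha0 ha using hmid
  refine ⟨⟨?_, ⟨a, ha0, ?_⟩, ?_⟩, ?_⟩
  · refine hsum _ _ (by positivity) fun i => ?_
    split_ifs with hi
    · have := hx i
      rw [if_pos hi, mem_ball_zero_iff, Real.norm_eq_abs] at this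
      refine hsq (this.trans_eq ?_)
      field_simp
    · positivity
  · refine hsum _ _ (by positivity) fun i => ?_
    split_ifs with hi
    · refine hsq ((ha i hi).trans_eq ?_)
      field_simp
    · positivity
  · have := hx (Fin.last n)
    rw [if_neg (by simp; omega), if_neg (by simp)] at this
    obtain ⟨-, j, hj⟩ := this
    refine ⟨j, hj.trans_le ?_⟩
    apply one_div_le_one_div_of_le (by norm_num)
    linarith [Nat.cast_nonneg (α := ℝ) n]
  · rw [mem_ball_zero_iff]
    refine lt_of_pow_lt_pow_left₀ 2 hR0.le ?_
    rw [EuclideanSpace.real_norm_sq_eq]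
    refine hsum _ _ hR0 fun i => hsq ?_
    have := hx i
    split_ifs at this
    · rw [mem_ball_zero_iff, Real.norm_eq_abs] at this
      refine this.trans_le ?_
      have h1 : R ^ (1 / 2 : ℝ) ≤ R := by
        simpa using Real.rpow_le_rpow_of_exponent_le hR (by norm_num : (1 / 2 : ℝ) ≤ 1)
      rw [one_div_mul_eq_div]
      apply div_le_div₀ hR0.le h1 (by positivity)
      linarith [Nat.cast_nonneg (α := ℝ) n]
    · exact this.1
    · exact this.1

theorem prod_ofReal_mul_rpow {ι : Type*} [Fintype ι] {C R : ℝ} (hC : 0 ≤ C) (hR : 0 < R)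
    (e : ι → ℝ) :
    ∏ i, ENNReal.ofReal (C * R ^ e i) =
      ENNReal.ofReal (C ^ Fintype.card ι * R ^ ∑ i, e i) := by
  rw [← ENNReal.ofReal_prod_of_nonneg fun i _ => by positivity, Finset.prod_mul_distrib,
    Finset.prod_const, Finset.card_univ, Real.rpow_sum_of_pos hR]

theorem rpow_lattice_ratio {κ R : ℝ} (hR : 0 < R) :
    R / (1 / (2 * Real.pi) * R ^ (2 * κ)) = 2 * Real.pi * R ^ (1 - 2 * κ) := by
  rw [Real.rpow_sub hR, Real.rpow_one]
  have := Real.pi_pos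
  field_simp

/-- `|Λ| ∼ R^{(n+1+k)/2 - κ(k+1)}` for all sufficiently large `R`. -/
theorem stmt3 (n k : ℕ) (hn : 1 ≤ n) (hk2 : 2 ≤ k) (hk : k ≤ n + 1)
    (κ : ℝ) (hκ0 : 0 < κ) (hκ : κ < 1 / 2) :
    ∃ c₁ c₂ R₀ : ℝ, 0 < c₁ ∧ c₁ ≤ c₂ ∧ 1 ≤ R₀ ∧
      ∀ R : ℝ, R₀ ≤ R →
        c₁ * R ^ (((n : ℝ) + 1 + k) / 2 - κ * ((k : ℝ) + 1))
            ≤ (volume (Lambda n k κ R)).toReal ∧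
        (volume (Lambda n k κ R)).toReal
            ≤ c₂ * R ^ (((n : ℝ) + 1 + k) / 2 - κ * ((k : ℝ) + 1)) := by
  have hn0 : (0 : ℝ) ≤ n := Nat.cast_nonneg n
  set ε : ℝ := 1 / (1000 * (n + 1)) with hε
  have hε0 : 0 < ε := by positivity
  have hε1 : ε ≤ 1 / 1000 := one_div_le_one_div_of_le (by norm_num) (by linarith)
  set α : ℝ := ε / (n + 1) with hα
  have hα0 : 0 < α := by positivity
  have hαε : α ≤ ε := div_le_self hε0.le (by linarith)
  have hsum : ∑ i, sideExponent n (n + 1 - k) κ i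
      = ((n : ℝ) + 1 + k) / 2 - κ * ((k : ℝ) + 1) := by
    obtain ⟨m, hm⟩ : ∃ m, n = m + (k - 1) := ⟨n - (k - 1), by omega⟩
    obtain ⟨l, rfl⟩ : ∃ l, k = l + 1 := ⟨k - 1, by omega⟩
    obtain rfl : n = m + l := by simpa using hm
    have : m + l + 1 - (l + 1) = m := by omega
    rw [this, sum_sideExponent]
    push_cast
    ring
  refine ⟨α ^ (n + 1), 1, ((n : ℝ) + 1) ^ (1 / (1 - 2 * κ)), by positivity,
    pow_le_one₀ hα0.le (by linarith),
    Real.one_le_rpow (by linarith) (div_nonneg zero_le_one (by linarith)), fun R hR => ?_⟩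
  have hR1 : 1 ≤ R :=
    (Real.one_le_rpow (by linarith) (div_nonneg zero_le_one (by linarith))).trans hR
  have hR0 : 0 < R := by linarith
  have hbig : (n : ℝ) + 1 ≤ R ^ (1 - 2 * κ) := by
    have h := Real.rpow_le_rpow (by positivity) hR (by linarith : 0 ≤ 1 - 2 * κ)
    rwa [← Real.rpow_mul (by positivity), one_div_mul_cancel (by linarith), Real.rpow_one] at h
  have hpi := Real.pi_gt_three
  have hpi4 := Real.pi_le_four
  have hd2 : R ^ (2 * κ) ≤ R / (n + 1) := by
    rw [le_div_iff₀ (by positivity)]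
    calc R ^ (2 * κ) * (n + 1) ≤ R ^ (2 * κ) * R ^ (1 - 2 * κ) := by gcongr
      _ = R := by rw [← Real.rpow_add hR0]; simp
  have hd1 : R ^ κ ≤ R / (n + 1) :=
    (Real.rpow_le_rpow_of_exponent_le hR1 (by linarith)).trans hd2
  have hone1 : 1 ≤ R ^ κ := Real.one_le_rpow hR1 hκ0.le
  have hone2 : 1 ≤ R ^ (2 * κ) := Real.one_le_rpow hR1 (by linarith)
  have hMR : R / (n + 1) ≤ R := div_le_self hR0.le (by linarith)
  have hinv : 1 / 8 ≤ 1 / (2 * Real.pi) :=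
    one_div_le_one_div_of_le (by positivity) (by linarith)
  have hinv1 : 1 / (2 * Real.pi) ≤ 1 := by
    rw [div_le_one (by positivity)]; linarith
  have hd2' : 1 / (2 * Real.pi) * R ^ (2 * κ) ≤ R / (n + 1) :=
    (mul_le_of_le_one_left (by positivity) hinv1).trans hd2
  have hone2' : 1 / 8 ≤ 1 / (2 * Real.pi) * R ^ (2 * κ) :=
    hinv.trans (le_mul_of_one_le_right (by positivity) hone2)
  have hratio : R / R ^ κ = R ^ (1 - κ) := by rw [Real.rpow_sub hR0, Real.rpow_one]
  have hupper : volume (Lambda n k κ R) ≤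
      ENNReal.ofReal (1 * R ^ (((n : ℝ) + 1 + k) / 2 - κ * ((k : ℝ) + 1))) := by
    refine (measure_mono (Lambda_subset_box n k hR0)).trans ?_
    have hprod := prod_ofReal_mul_rpow zero_le_one hR0 (sideExponent n (n + 1 - k) κ)
    rw [one_pow, hsum] at hprod
    rw [volume_euclidean_box, ← hprod]
    refine Finset.prod_le_prod' fun i _ => ?_
    unfold latticeBox sideExponent
    split_ifs
    · rw [Real.volume_ball]
      apply ENNReal.ofReal_le_ofReal
      have : 0 < R ^ (1 / 2 : ℝ) := by positivity
      linarith
    · refine (volume_latticeNeighborhood_le (by norm_num) (by linarith) (by linarith)).trans ?_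
      apply ENNReal.ofReal_le_ofReal
      rw [hratio]
      have : 0 < R ^ (1 - κ) := by positivity
      linarith
    · refine (volume_latticeNeighborhood_le (by norm_num) (by linarith) (by linarith)).trans ?_
      apply ENNReal.ofReal_le_ofReal
      rw [rpow_lattice_ratio hR0]
      have : 0 < R ^ (1 - 2 * κ) := by positivity
      nlinarith
  have hlower : ENNReal.ofReal (α ^ (n + 1) * R ^ (((n : ℝ) + 1 + k) / 2 - κ * ((k : ℝ) + 1)))
      ≤ volume (Lambda n k κ R) := by
    refine le_trans ?_ (measure_mono (box_subset_Lambda n k hk2 hR1))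
    have hprod := prod_ofReal_mul_rpow hα0.le hR0 (sideExponent n (n + 1 - k) κ)
    rw [Fintype.card_fin, hsum] at hprod
    rw [volume_euclidean_box, ← hprod]
    refine Finset.prod_le_prod' fun i _ => ?_
    unfold latticeBox sideExponent
    split_ifs
    · rw [Real.volume_ball]
      apply ENNReal.ofReal_le_ofReal
      have : 0 < R ^ (1 / 2 : ℝ) := by positivity
      nlinarith
    · refine le_trans ?_ (le_volume_latticeNeighborhood hε0 (by linarith) hd1)
      apply ENNReal.ofReal_le_ofReal
      rw [div_right_comm, hratio, hα]
      exact (by ring : _ = _).le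
    · refine le_trans ?_ (le_volume_latticeNeighborhood hε0 (by linarith) hd2')
      apply ENNReal.ofReal_le_ofReal
      rw [div_right_comm, rpow_lattice_ratio hR0]
      calc α * R ^ (1 - 2 * κ) ≤ 2 * Real.pi * (α * R ^ (1 - 2 * κ)) :=
            le_mul_of_one_le_left (by positivity) (by linarith)
        _ = ε * (2 * Real.pi * R ^ (1 - 2 * κ) / (n + 1)) := by rw [hα]; ring
  constructor
  · rw [← ENNReal.ofReal_le_iff_le_toReal (ne_top_of_le_ne_top ENNReal.ofReal_ne_top hupper)]
    exact hlower
  · exact ENNReal.toReal_le_of_le_ofReal (by positivity) hupper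
end

section
/- For every ξ = (ξ', ξ'') ∈ Ω and every x = (x', x'', x_{n+1}) ∈ Λ, the phase x'·ξ' + x''·ξ'' + x_{n+1}|ξ'|² + x_{n+1}|ξ''|² lies in 2πℤ + (−1/100, 1/100); that is, there exists an integer j with |x'·ξ' + x''·ξ'' + x_{n+1}|ξ|² − 2πj| < 1/100. -/
open MeasureTheory Metric

/-- The set `Ω := [B^{n+1-k}(0, cR^{-1/2}) × (2πR^{-κ}ℤ^{k-1} + B^{k-1}(0, cR^{-1}))] ∩ B^n(0,1)`
in `ℝ^n`, with `c = 1/1000`, coordinates split as `ξ = (ξ', ξ'') ∈ ℝ^{n+1-k} × ℝ^{k-1}`. -/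
noncomputable def Omega (n k : ℕ) (κ R : ℝ) : Set (EuclideanSpace ℝ (Fin n)) :=
  {ξ : EuclideanSpace ℝ (Fin n) |
      (∑ i : Fin n, if (i : ℕ) < n + 1 - k then ξ i ^ 2 else 0)
          < ((1 / 1000 : ℝ) * R ^ (-(1 : ℝ) / 2)) ^ 2 ∧
      ∃ b : Fin n → ℤ, (∀ i : Fin n, (i : ℕ) < n + 1 - k → b i = 0) ∧
        (∑ i : Fin n, if n + 1 - k ≤ (i : ℕ)
            then (ξ i - 2 * Real.pi * R ^ (-κ) * b i) ^ 2 else 0)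
          < ((1 / 1000 : ℝ) * R⁻¹) ^ 2} ∩
    ball (0 : EuclideanSpace ℝ (Fin n)) 1

/-- Cauchy–Schwarz for finite sums, in terms of bounds on the two factors. -/
lemma abs_sum_mul_le_of_sum_sq_le {ι : Type*} [Fintype ι] {f g : ι → ℝ} {A B : ℝ}
    (hA : 0 ≤ A) (hB : 0 ≤ B) (hf : ∑ i, f i ^ 2 ≤ A ^ 2) (hg : ∑ i, g i ^ 2 ≤ B ^ 2) :
    |∑ i, f i * g i| ≤ A * B := by
  apply abs_le_of_sq_le_sq _ (by positivity)
  calc (∑ i, f i * g i) ^ 2 ≤ (∑ i, f i ^ 2) * ∑ i, g i ^ 2 :=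
        Finset.sum_mul_sq_le_sq_mul_sq _ _ _
    _ ≤ A ^ 2 * B ^ 2 := by gcongr
    _ = (A * B) ^ 2 := by ring

/-- The linear phase `⟨x, ξ⟩` is close to a multiple of `2π` when `x` and `ξ` are close to dual
lattices. -/
lemma abs_sum_mul_sub_lattice_le {ι : Type*} [Fintype ι] {x ξ : ι → ℝ} {a b : ι → ℤ}
    {q c R : ℝ} (hq : 0 < q) (hc : 0 ≤ c) (hR : 1 ≤ R)
    (hx : ∑ i, x i ^ 2 ≤ R ^ 2) (hξ : ∑ i, ξ i ^ 2 ≤ 1)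
    (hxa : ∑ i, (x i - q * a i) ^ 2 ≤ c ^ 2)
    (hξb : ∑ i, (ξ i - 2 * Real.pi * q⁻¹ * b i) ^ 2 ≤ (c * R⁻¹) ^ 2) :
    |∑ i, x i * ξ i - 2 * Real.pi * ((∑ i, a i * b i : ℤ) : ℝ)| ≤ 2 * c + c ^ 2 := by
  have hR0 : 0 < R := by linarith
  have hRi : R⁻¹ ≤ 1 := inv_le_one_of_one_le₀ hR
  have h₁ := abs_sum_mul_le_of_sum_sq_le hR0.le (by positivity) hx hξb
  have h₂ := abs_sum_mul_le_of_sum_sq_le hc zero_le_one hxa (by simpa using hξ)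
  have h₃ := abs_sum_mul_le_of_sum_sq_le hc (by positivity) hxa hξb
  have e : ∑ i, x i * ξ i - 2 * Real.pi * ((∑ i, a i * b i : ℤ) : ℝ) =
      ∑ i, x i * (ξ i - 2 * Real.pi * q⁻¹ * b i) + ∑ i, (x i - q * a i) * ξ i
        - ∑ i, (x i - q * a i) * (ξ i - 2 * Real.pi * q⁻¹ * b i) := by
    push_cast
    rw [Finset.mul_sum, ← Finset.sum_sub_distrib, ← Finset.sum_add_distrib,
      ← Finset.sum_sub_distrib]
    refine Finset.sum_congr rfl fun i _ => ?_
    field_simp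
    ring
  have e₁ : R * (c * R⁻¹) = c := by field_simp
  have e₃ : c * (c * R⁻¹) ≤ c ^ 2 := by nlinarith [mul_nonneg hc hc]
  rw [e, abs_le]
  rw [abs_le] at h₁ h₂ h₃
  constructor <;> linarith [h₁.1, h₁.2, h₂.1, h₂.2, h₃.1, h₃.2]

/-- The quadratic phase `t|ξ|²` is close to a multiple of `2π` when `ξ` is close to the lattice
`2πq⁻¹ℤ^ι` and `t` is close to `(2π)⁻¹q²ℤ`. -/
lemma abs_mul_sum_sq_sub_lattice_le {ι : Type*} [Fintype ι] {ξ : ι → ℝ} {b : ι → ℤ} {j : ℤ}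
    {t q c R : ℝ} (hq : 0 < q) (hc : 0 ≤ c) (hR : 1 ≤ R)
    (ht : |t| ≤ R) (htj : |t - 1 / (2 * Real.pi) * q ^ 2 * j| ≤ c)
    (hξ : ∑ i, ξ i ^ 2 ≤ 1)
    (hξb : ∑ i, (ξ i - 2 * Real.pi * q⁻¹ * b i) ^ 2 ≤ (c * R⁻¹) ^ 2) :
    |t * ∑ i, ξ i ^ 2 - 2 * Real.pi * ((j * ∑ i, b i ^ 2 : ℤ) : ℝ)| ≤
      2 * c + c ^ 2 + c * (1 + c) ^ 2 := by
  have hR0 : 0 < R := by linarith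
  have hRi : R⁻¹ ≤ 1 := inv_le_one_of_one_le₀ hR
  have hRi0 : 0 < R⁻¹ := by positivity
  have hcR : c * R⁻¹ ≤ c := by nlinarith
  have hcR0 : 0 ≤ c * R⁻¹ := by positivity
  have h₁ := abs_sum_mul_le_of_sum_sq_le zero_le_one hcR0 (by simpa using hξ) hξb
  set w : ι → ℝ := fun i => 2 * Real.pi * q⁻¹ * b i
  set A := ∑ i, ξ i * (ξ i - w i)
  set V := ∑ i, (ξ i - w i) ^ 2
  have hV : 0 ≤ V := Finset.sum_nonneg fun i _ => sq_nonneg _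
  have hW : ∑ i, w i ^ 2 = ∑ i, ξ i ^ 2 - 2 * A + V := by
    simp only [A, V]
    rw [Finset.mul_sum, ← Finset.sum_sub_distrib, ← Finset.sum_add_distrib]
    exact Finset.sum_congr rfl fun i _ => by ring
  have hb : ∑ i, w i ^ 2 = (2 * Real.pi * q⁻¹) ^ 2 * ∑ i, (b i : ℝ) ^ 2 := by
    rw [Finset.mul_sum]
    exact Finset.sum_congr rfl fun i _ => by ring
  have hW0 : 0 ≤ ∑ i, w i ^ 2 := Finset.sum_nonneg fun i _ => sq_nonneg _
  have hA : |2 * A - V| ≤ (2 * c + c ^ 2) * R⁻¹ := by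
    rw [abs_le] at h₁ ⊢
    have : (c * R⁻¹) ^ 2 ≤ c ^ 2 * R⁻¹ := by nlinarith [mul_nonneg hc hcR0]
    constructor <;> nlinarith [h₁.1, h₁.2]
  have hW1 : ∑ i, w i ^ 2 ≤ (1 + c) ^ 2 := by
    rw [hW]
    rw [abs_le] at h₁
    nlinarith [h₁.1]
  have e : t * ∑ i, ξ i ^ 2 - 2 * Real.pi * ((j * ∑ i, b i ^ 2 : ℤ) : ℝ) =
      t * (2 * A - V) + (t - 1 / (2 * Real.pi) * q ^ 2 * j) * ∑ i, w i ^ 2 := by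
    have hj : 1 / (2 * Real.pi) * q ^ 2 * j * ∑ i, w i ^ 2 =
        2 * Real.pi * ((j * ∑ i, b i ^ 2 : ℤ) : ℝ) := by
      rw [hb]
      push_cast
      have := Real.pi_pos
      field_simp
    rw [sub_mul, hj, hW]
    ring
  rw [e]
  refine (abs_add_le _ _).trans (add_le_add ?_ ?_)
  · rw [abs_mul]
    calc |t| * |2 * A - V| ≤ R * ((2 * c + c ^ 2) * R⁻¹) := by gcongr
      _ = 2 * c + c ^ 2 := by field_simp
  · rw [abs_mul, abs_of_nonneg hW0]
    gcongr

/-- For every `ξ ∈ Ω` and `x ∈ Λ`, the phase `x'·ξ' + x''·ξ'' + x_{n+1}|ξ|²` lies in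
`2πℤ + (-1/100, 1/100)`. -/
theorem stmt4 (n k : ℕ) (hn : 1 ≤ n) (hk2 : 2 ≤ k) (hk : k ≤ n + 1)
    (κ : ℝ) (hκ0 : 0 < κ) (hκ : κ < 1 / 2) (R : ℝ) (hR : 1 ≤ R)
    (ξ : EuclideanSpace ℝ (Fin n)) (hξ : ξ ∈ Omega n k κ R)
    (x : EuclideanSpace ℝ (Fin (n + 1))) (hx : x ∈ Lambda n k κ R) :
    ∃ j : ℤ, |(∑ i : Fin n, x i.castSucc * ξ i) + x (Fin.last n) * ‖ξ‖ ^ 2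
        - 2 * Real.pi * j| < 1 / 100 := by
  have hR0 : 0 < R := by linarith
  obtain ⟨⟨hξ', b, hb0, hξb⟩, hξ1⟩ := hξ
  obtain ⟨⟨hx', ⟨a, -, hxa⟩, j, hj⟩, hxR⟩ := hx
  rw [mem_ball_zero_iff] at hξ1 hxR
  have hq : 0 < R ^ κ := by positivity
  rw [Real.rpow_neg hR0.le] at hξb
  have hq2 : R ^ (2 * κ) = (R ^ κ) ^ 2 := by
    rw [mul_comm, Real.rpow_mul hR0.le, Real.rpow_two]
  rw [hq2] at hj
  have hs : R ^ ((1 : ℝ) / 2) * R ^ (-(1 : ℝ) / 2) = 1 := by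
    rw [← Real.rpow_add hR0]; norm_num
  have hs2 : (R ^ (-(1 : ℝ) / 2)) ^ 2 = R⁻¹ := by
    rw [← Real.rpow_two, ← Real.rpow_mul hR0.le, ← Real.rpow_neg_one]; norm_num
  have hlast : ¬ n < n + 1 - k := by omega
  rw [Fin.sum_univ_castSucc] at hx' hxa
  simp only [Fin.val_castSucc, Fin.val_last, hlast, lt_irrefl, and_false, if_false, add_zero,
    Fin.is_lt, and_true] at hx' hxa
  set m := n + 1 - k
  have hξn : ‖ξ‖ ^ 2 = ∑ i, ξ i ^ 2 := EuclideanSpace.real_norm_sq_eq ξ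
  have hξ1' : ∑ i, ξ i ^ 2 ≤ 1 := by
    rw [← hξn]; nlinarith [norm_nonneg ξ]
  have hxn : ∑ i : Fin n, x i.castSucc ^ 2 + x (Fin.last n) ^ 2 ≤ R ^ 2 := by
    rw [← Fin.sum_univ_castSucc (fun i => x i ^ 2), ← EuclideanSpace.real_norm_sq_eq]
    gcongr
  have hX0 : 0 ≤ ∑ i : Fin n, x i.castSucc ^ 2 := Finset.sum_nonneg fun i _ => sq_nonneg _
  have ht : |x (Fin.last n)| ≤ R := abs_le_of_sq_le_sq (by linarith) hR0.le
  let P : Fin n → ℝ := fun i => if (i : ℕ) < m then ξ i else 0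
  let Q : Fin n → ℝ := fun i => if m ≤ (i : ℕ) then ξ i else 0
  let X : Fin n → ℝ := fun i => if (i : ℕ) < m then x i.castSucc else 0
  let Y : Fin n → ℝ := fun i => if m ≤ (i : ℕ) then x i.castSucc else 0
  let a' : Fin n → ℤ := fun i => if m ≤ (i : ℕ) then a i.castSucc else 0
  have hP : ∑ i, P i ^ 2 ≤ (1 / 1000 * R ^ (-(1 : ℝ) / 2)) ^ 2 := by
    refine le_trans (le_of_eq ?_) hξ'.le
    exact Finset.sum_congr rfl fun i _ => by simp only [P]; split_ifs <;> simp
  have hX : ∑ i, X i ^ 2 ≤ (1 / 1000 * R ^ ((1 : ℝ) / 2)) ^ 2 := by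
    refine le_trans (le_of_eq ?_) hx'.le
    exact Finset.sum_congr rfl fun i _ => by simp only [X]; split_ifs <;> simp
  have hQ : ∑ i, Q i ^ 2 ≤ 1 := by
    refine le_trans (Finset.sum_le_sum fun i _ => ?_) hξ1'
    simp only [Q]; split_ifs
    · exact le_rfl
    · simpa using sq_nonneg _
  have hY : ∑ i, Y i ^ 2 ≤ R ^ 2 := by
    refine le_trans (Finset.sum_le_sum fun i _ => ?_)
      ((le_add_of_nonneg_right (sq_nonneg _)).trans hxn)
    simp only [Y]; split_ifs
    · exact le_rfl
    · simpa using sq_nonneg _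
  have hQb : ∑ i, (Q i - 2 * Real.pi * (R ^ κ)⁻¹ * b i) ^ 2 ≤ (1 / 1000 * R⁻¹) ^ 2 := by
    refine le_trans (le_of_eq ?_) hξb.le
    refine Finset.sum_congr rfl fun i _ => ?_
    simp only [Q]; split_ifs with h
    · rfl
    · simp [hb0 i (not_le.mp h)]
  have hYa : ∑ i, (Y i - R ^ κ * a' i) ^ 2 ≤ (1 / 1000) ^ 2 := by
    refine le_trans (le_of_eq ?_) hxa.le
    exact Finset.sum_congr rfl fun i _ => by simp only [Y, a']; split_ifs <;> simp
  have h₁ := abs_sum_mul_le_of_sum_sq_le (by positivity) (by positivity) hX hP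
  have h₂ := abs_sum_mul_sub_lattice_le hq (by norm_num) hR hY hQ hYa hQb
  have h₃ := abs_mul_sum_sq_sub_lattice_le hq (by norm_num) hR ht hj.le hQ hQb
  have h₄ : |x (Fin.last n) * ∑ i, P i ^ 2| ≤ 1 / 1000000 := by
    rw [abs_mul, abs_of_nonneg (Finset.sum_nonneg fun i _ => sq_nonneg (P i))]
    calc _ ≤ R * (1 / 1000 * R ^ (-(1 : ℝ) / 2)) ^ 2 := by gcongr
      _ = 1 / 1000000 := by rw [mul_pow, hs2]; field_simp; norm_num
  have e₁ : 1 / 1000 * R ^ ((1 : ℝ) / 2) * (1 / 1000 * R ^ (-(1 : ℝ) / 2)) = 1 / 1000000 := by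
    linear_combination (1 / 1000000) * hs
  rw [e₁] at h₁
  have e : (∑ i : Fin n, x i.castSucc * ξ i) = ∑ i, X i * P i + ∑ i, Y i * Q i := by
    rw [← Finset.sum_add_distrib]
    refine Finset.sum_congr rfl fun i _ => ?_
    rcases lt_or_ge (i : ℕ) m with h | h
    · simp [X, P, Y, Q, h, h.not_ge]
    · simp [X, P, Y, Q, h, h.not_gt]
  have e' : ‖ξ‖ ^ 2 = ∑ i, P i ^ 2 + ∑ i, Q i ^ 2 := by
    rw [hξn, ← Finset.sum_add_distrib]
    refine Finset.sum_congr rfl fun i _ => ?_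
    rcases lt_or_ge (i : ℕ) m with h | h
    · simp [P, Q, h, h.not_ge]
    · simp [P, Q, h, h.not_gt]
  refine ⟨∑ i, a' i * b i + j * ∑ i, b i ^ 2, ?_⟩
  rw [e, e', Int.cast_add, mul_add, mul_add, abs_lt]
  rw [abs_le] at h₁ h₂ h₃ h₄
  constructor <;> linarith [h₁.1, h₁.2, h₂.1, h₂.2, h₃.1, h₃.2, h₄.1, h₄.2]
end

section
/- Let g = 1_Ω be the characteristic function of Ω. Then for every x ∈ Λ one has |Eg(x)| ≥ cos(1/100) · |Ω|, where |Ω| is the Lebesgue measure of Ω; in particular |Eg(x)| is comparable to |Ω| on Λ. -/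
open MeasureTheory Metric

/-- The Fourier extension operator over the truncated paraboloid: for `f` supported in
`B^d(0,1) ⊂ ℝ^d`, `Ef(x) = ∫_{B^d(0,1)} e^{i(x'·ξ + x_{d+1}|ξ|²)} f(ξ) dξ`. -/
noncomputable def extOp (d : ℕ) (f : EuclideanSpace ℝ (Fin d) → ℂ)
    (x : EuclideanSpace ℝ (Fin (d + 1))) : ℂ :=
  ∫ ξ in ball (0 : EuclideanSpace ℝ (Fin d)) 1,
    Complex.exp (Complex.I *
      (((∑ i, x i.castSucc * ξ i) + x (Fin.last d) * ‖ξ‖ ^ 2 : ℝ) : ℂ)) * f ξ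

open scoped RealInnerProductSpace

/-- Perturbation bound for the phase `⟪x₁ + x₂, ξ₁ + ξ₂⟫ + t * ‖ξ₁ + ξ₂‖ ^ 2` around its value at
the points `A`, `B`, `T` close to `x₂`, `ξ₂`, `t`. -/
theorem abs_phase_sub_le {V : Type*} [NormedAddCommGroup V] [InnerProductSpace ℝ V]
    {x₁ x₂ ξ₁ ξ₂ A B : V} {t T R q : ℝ} (hR : 1 ≤ R) (hq : 0 < q) (hqR : q ^ 2 = R)
    (hx₁ : ‖x₁‖ ≤ 1 / 1000 * q) (hξ₁ : ‖ξ₁‖ ≤ 1 / 1000 * q⁻¹)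
    (hx₂ : ‖x₂‖ ≤ R) (hξ₂ : ‖ξ₂‖ ≤ 1) (ht : |t| ≤ R)
    (hA : ‖x₂ - A‖ ≤ 1 / 1000) (hB : ‖ξ₂ - B‖ ≤ 1 / 1000 * R⁻¹) (hT : |t - T| ≤ 1 / 1000) :
    |⟪x₁, ξ₁⟫ + ⟪x₂, ξ₂⟫ + t * (‖ξ₁‖ ^ 2 + ‖ξ₂‖ ^ 2) - (⟪A, B⟫ + T * ‖B‖ ^ 2)| ≤ 1 / 100 := by
  have hR0 : 0 < R := by linarith
  have hv : R * ‖ξ₂ - B‖ ≤ 1 / 1000 := by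
    calc R * ‖ξ₂ - B‖ ≤ R * (1 / 1000 * R⁻¹) := by gcongr
      _ = 1 / 1000 := by field_simp
  have hv' : ‖ξ₂ - B‖ ≤ 1 / 1000 := by nlinarith [norm_nonneg (ξ₂ - B)]
  have hAn : ‖A‖ ≤ R + 1 / 1000 := by
    have := norm_sub_norm_le A x₂
    rw [norm_sub_rev] at this
    linarith
  have hTn : |T| ≤ R + 1 / 1000 := by
    have := abs_sub_abs_le_abs_sub T t
    rw [abs_sub_comm] at this
    linarith
  have hBn : ‖ξ₂ + B‖ ≤ 2 + 1 / 1000 := by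
    have h : ξ₂ + B = ξ₂ + ξ₂ - (ξ₂ - B) := by abel
    rw [h]
    linarith [norm_sub_le (ξ₂ + ξ₂) (ξ₂ - B), norm_add_le ξ₂ ξ₂]
  have e₁ : |⟪x₁, ξ₁⟫| ≤ 1 / 1000000 := by
    calc _ ≤ ‖x₁‖ * ‖ξ₁‖ := abs_real_inner_le_norm _ _
      _ ≤ (1 / 1000 * q) * (1 / 1000 * q⁻¹) := by gcongr
      _ = 1 / 1000000 := by field_simp; norm_num
  have e₂ : |⟪x₂ - A, ξ₂⟫| ≤ 1 / 1000 := by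
    calc _ ≤ ‖x₂ - A‖ * ‖ξ₂‖ := abs_real_inner_le_norm _ _
      _ ≤ 1 / 1000 * 1 := by gcongr
      _ = 1 / 1000 := by norm_num
  have e₃ : |⟪A, ξ₂ - B⟫| ≤ 1 / 1000 + 1 / 1000000 := by
    calc _ ≤ ‖A‖ * ‖ξ₂ - B‖ := abs_real_inner_le_norm _ _
      _ ≤ (R + 1 / 1000) * ‖ξ₂ - B‖ := by gcongr
      _ ≤ _ := by linarith
  have e₄ : |t * ‖ξ₁‖ ^ 2| ≤ 1 / 1000000 := by
    rw [abs_mul, abs_of_nonneg (sq_nonneg ‖ξ₁‖)]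
    calc _ ≤ R * (1 / 1000 * q⁻¹) ^ 2 := by gcongr
      _ = 1 / 1000000 := by rw [← hqR]; field_simp; norm_num
  have e₅ : |(t - T) * ‖ξ₂‖ ^ 2| ≤ 1 / 1000 := by
    rw [abs_mul, abs_of_nonneg (sq_nonneg ‖ξ₂‖)]
    calc _ ≤ (1 / 1000) * (1 : ℝ) ^ 2 := by gcongr
      _ = 1 / 1000 := by norm_num
  have e₆ : |T * ⟪ξ₂ + B, ξ₂ - B⟫| ≤ 3 / 1000 := by
    rw [abs_mul]
    calc _ ≤ (R + 1 / 1000) * (‖ξ₂ + B‖ * ‖ξ₂ - B‖) := by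
          gcongr; exact abs_real_inner_le_norm _ _
      _ ≤ (R + 1 / 1000) * ((2 + 1 / 1000) * ‖ξ₂ - B‖) := by gcongr
      _ ≤ _ := by linarith
  have key : ⟪x₁, ξ₁⟫ + ⟪x₂, ξ₂⟫ + t * (‖ξ₁‖ ^ 2 + ‖ξ₂‖ ^ 2) - (⟪A, B⟫ + T * ‖B‖ ^ 2) =
      ⟪x₁, ξ₁⟫ + ⟪x₂ - A, ξ₂⟫ + ⟪A, ξ₂ - B⟫ + t * ‖ξ₁‖ ^ 2 + (t - T) * ‖ξ₂‖ ^ 2 +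
        T * ⟪ξ₂ + B, ξ₂ - B⟫ := by
    simp only [← real_inner_self_eq_norm_sq, inner_sub_left, inner_sub_right, inner_add_left,
      real_inner_comm ξ₂ B]
    ring
  rw [key]
  rw [abs_le] at *
  constructor <;> linarith

theorem isOpen_Omega (n k : ℕ) (κ R : ℝ) : IsOpen (Omega n k κ R) := by
  refine IsOpen.inter ?_ isOpen_ball
  refine IsOpen.and (isOpen_lt ?_ continuous_const) ?_
  · refine continuous_finsetSum _ fun i _ => ?_
    split_ifs <;> fun_prop
  · simp only [Set.ofPred_exists, Set.ofPred_and]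
    refine isOpen_iUnion fun b => isOpen_const.inter (isOpen_lt ?_ continuous_const)
    refine continuous_finsetSum _ fun i _ => ?_
    split_ifs <;> fun_prop

/-- On `Λ × Ω` the phase lies within `1/100` of `2πℤ`. -/
theorem exists_int_abs_phase_sub_le {n k : ℕ} (hk2 : 2 ≤ k) {κ R : ℝ} (hR : 1 ≤ R)
    {x : EuclideanSpace ℝ (Fin (n + 1))} (hx : x ∈ Lambda n k κ R)
    {ξ : EuclideanSpace ℝ (Fin n)} (hξ : ξ ∈ Omega n k κ R) :
    ∃ m : ℤ, |(∑ i, x i.castSucc * ξ i) + x (Fin.last n) * ‖ξ‖ ^ 2 - m * (2 * Real.pi)|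
      ≤ 1 / 100 := by
  obtain ⟨⟨hx₁, ⟨a, -, hxa⟩, j, hj⟩, hxR⟩ := hx
  obtain ⟨⟨hξ₁, b, -, hξb⟩, hξ1⟩ := hξ
  have hR0 : 0 < R := by linarith
  have hRκ : R ^ κ ≠ 0 := (Real.rpow_pos_of_pos hR0 κ).ne'
  rw [mem_ball_zero_iff] at hxR hξ1
  rw [Fin.sum_univ_castSucc] at hx₁ hxa
  have hlast : ¬ (n < n + 1 - k) := by omega
  simp only [Fin.val_castSucc, Fin.val_last, hlast, lt_irrefl, and_false, if_false, add_zero,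
    Fin.is_lt, and_true] at hx₁ hxa
  have hxsq : (∑ i : Fin n, x i.castSucc ^ 2) + x (Fin.last n) ^ 2 = ‖x‖ ^ 2 := by
    rw [EuclideanSpace.real_norm_sq_eq, Fin.sum_univ_castSucc]
  have hsum0 : 0 ≤ ∑ i : Fin n, x i.castSucc ^ 2 := Finset.sum_nonneg fun i _ => sq_nonneg _
  have hxsqR : ‖x‖ ^ 2 ≤ R ^ 2 := by gcongr
  let p : Fin n → Prop := fun i => (i : ℕ) < n + 1 - k
  let y₁ : EuclideanSpace ℝ (Fin n) := WithLp.toLp 2 fun i => if p i then x i.castSucc else 0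
  let y₂ : EuclideanSpace ℝ (Fin n) := WithLp.toLp 2 fun i => if p i then 0 else x i.castSucc
  let ξ₁ : EuclideanSpace ℝ (Fin n) := WithLp.toLp 2 fun i => if p i then ξ i else 0
  let ξ₂ : EuclideanSpace ℝ (Fin n) := WithLp.toLp 2 fun i => if p i then 0 else ξ i
  let A : EuclideanSpace ℝ (Fin n) :=
    WithLp.toLp 2 fun i => if p i then 0 else R ^ κ * a i.castSucc
  let B : EuclideanSpace ℝ (Fin n) :=
    WithLp.toLp 2 fun i => if p i then 0 else 2 * Real.pi * R ^ (-κ) * b i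
  let T : ℝ := 1 / (2 * Real.pi) * R ^ (2 * κ) * j
  have hinner (v w : EuclideanSpace ℝ (Fin n)) : ⟪v, w⟫ = ∑ i, v i * w i := by
    simp [PiLp.inner_apply, mul_comm]
  have hsq : R ^ ((1 : ℝ) / 2) = √R := (Real.sqrt_eq_rpow R).symm
  have hsq' : R ^ (-(1 : ℝ) / 2) = (√R)⁻¹ := by
    rw [← hsq, ← Real.rpow_neg hR0.le]; congr 1; norm_num
  have hy₂ : ‖y₂‖ ≤ R := by
    refine le_of_sq_le_sq ?_ hR0.le
    rw [EuclideanSpace.real_norm_sq_eq]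
    calc _ ≤ ∑ i : Fin n, x i.castSucc ^ 2 := by
          refine Finset.sum_le_sum fun i _ => ?_
          simp only [y₂]; split_ifs <;> simp [sq_nonneg]
      _ ≤ _ := by nlinarith [sq_nonneg (x (Fin.last n))]
  have hξ₂ : ‖ξ₂‖ ≤ 1 := by
    refine le_trans (le_of_sq_le_sq ?_ (norm_nonneg ξ)) hξ1.le
    rw [EuclideanSpace.real_norm_sq_eq, EuclideanSpace.real_norm_sq_eq]
    refine Finset.sum_le_sum fun i _ => ?_
    simp only [ξ₂]; split_ifs <;> simp [sq_nonneg]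
  have ht : |x (Fin.last n)| ≤ R := abs_le_of_sq_le_sq (by linarith) hR0.le
  have h := abs_phase_sub_le (x₁ := y₁) (x₂ := y₂) (ξ₁ := ξ₁) (ξ₂ := ξ₂) (A := A) (B := B)
    (t := x (Fin.last n)) (T := T) hR (Real.sqrt_pos.2 hR0) (Real.sq_sqrt hR0.le)
    (by
      refine le_of_sq_le_sq ?_ (by positivity)
      rw [EuclideanSpace.real_norm_sq_eq, ← hsq]
      refine le_of_eq_of_le (Finset.sum_congr rfl fun i _ => ?_) hx₁.le
      simp only [y₁, p]; split_ifs <;> simp)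
    (by
      refine le_of_sq_le_sq ?_ (by positivity)
      rw [EuclideanSpace.real_norm_sq_eq, ← hsq']
      refine le_of_eq_of_le (Finset.sum_congr rfl fun i _ => ?_) hξ₁.le
      simp only [ξ₁, p]; split_ifs <;> simp)
    hy₂ hξ₂ ht
    (by
      refine le_of_sq_le_sq ?_ (by positivity)
      rw [EuclideanSpace.real_norm_sq_eq]
      refine le_of_eq_of_le (Finset.sum_congr rfl fun i _ => ?_) hxa.le
      simp only [y₂, A, p, PiLp.sub_apply, ← not_lt]; split_ifs <;> simp)
    (by
      refine le_of_sq_le_sq ?_ (by positivity)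
      rw [EuclideanSpace.real_norm_sq_eq]
      refine le_of_eq_of_le (Finset.sum_congr rfl fun i _ => ?_) hξb.le
      simp only [ξ₂, B, p, PiLp.sub_apply, ← not_lt]; split_ifs <;> simp)
    hj.le
  refine ⟨∑ i, (if p i then 0 else a i.castSucc * b i) + j * ∑ i, (if p i then 0 else b i ^ 2), ?_⟩
  have hphase : ⟪y₁, ξ₁⟫ + ⟪y₂, ξ₂⟫ = ∑ i, x i.castSucc * ξ i := by
    rw [hinner, hinner, ← Finset.sum_add_distrib]
    refine Finset.sum_congr rfl fun i _ => ?_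
    simp only [y₁, y₂, ξ₁, ξ₂]; split_ifs <;> simp
  have hnorm : ‖ξ₁‖ ^ 2 + ‖ξ₂‖ ^ 2 = ‖ξ‖ ^ 2 := by
    simp only [EuclideanSpace.real_norm_sq_eq]
    rw [← Finset.sum_add_distrib]
    refine Finset.sum_congr rfl fun i _ => ?_
    simp only [ξ₁, ξ₂]; split_ifs <;> simp
  have hAB : ⟪A, B⟫ = (∑ i, (if p i then 0 else a i.castSucc * b i) : ℤ) * (2 * Real.pi) := by
    rw [hinner]
    push_cast
    rw [Finset.sum_mul]
    refine Finset.sum_congr rfl fun i _ => ?_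
    simp only [A, B, Real.rpow_neg hR0.le]
    split_ifs
    · simp
    · field_simp
  have hTB : T * ‖B‖ ^ 2 = (j * ∑ i, (if p i then 0 else b i ^ 2) : ℤ) * (2 * Real.pi) := by
    rw [EuclideanSpace.real_norm_sq_eq]
    push_cast
    rw [Finset.mul_sum, Finset.mul_sum, Finset.sum_mul]
    refine Finset.sum_congr rfl fun i _ => ?_
    have h2 : R ^ (2 * κ) = (R ^ κ) ^ 2 := by
      rw [mul_comm, Real.rpow_mul hR0.le]; norm_cast
    simp only [B, T, Real.rpow_neg hR0.le, h2]
    split_ifs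
    · simp
    · have := Real.pi_ne_zero
      field_simp
  rw [hphase, hnorm, hAB, hTB, ← add_mul] at h
  exact_mod_cast h

theorem Real.cos_le_cos_of_abs_sub_int_mul_two_pi_le {θ r : ℝ} (hr : r ≤ Real.pi) {m : ℤ}
    (h : |θ - m * (2 * Real.pi)| ≤ r) : Real.cos r ≤ Real.cos θ := by
  rw [← Real.cos_sub_int_mul_two_pi θ m, ← Real.cos_abs (θ - _)]
  exact Real.cos_le_cos_of_nonneg_of_le_pi (abs_nonneg _) hr h

/-- If `cos θ ≥ a` on `s`, then `∫ e^{iθ}` over `s` has norm at least `a` times the measure. -/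
theorem mul_measureReal_le_norm_setIntegral_exp {α : Type*} [MeasurableSpace α] {μ : Measure α}
    {s : Set α} (hs : MeasurableSet s) (hμs : μ s ≠ ⊤) {θ : α → ℝ} (hθ : Measurable θ) {a : ℝ}
    (h : ∀ y ∈ s, a ≤ Real.cos (θ y)) :
    a * μ.real s ≤ ‖∫ y in s, Complex.exp (Complex.I * (θ y : ℂ)) ∂μ‖ := by
  have hint : IntegrableOn (fun y => Complex.exp (Complex.I * (θ y : ℂ))) s μ := by
    refine Measure.integrableOn_of_bounded (M := 1) hμs (by fun_prop) ?_
    filter_upwards with y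
    rw [mul_comm, Complex.norm_exp_ofReal_mul_I]
  have hre (y : α) : (Complex.exp (Complex.I * (θ y : ℂ))).re = Real.cos (θ y) := by
    rw [mul_comm, Complex.exp_ofReal_mul_I_re]
  have hcos : IntegrableOn (fun y => Real.cos (θ y)) s μ := by
    simpa only [RCLike.re_to_complex, hre] using! hint.re
  calc a * μ.real s = ∫ _ in s, a ∂μ := by simp [mul_comm]
    _ ≤ ∫ y in s, Real.cos (θ y) ∂μ :=
        setIntegral_mono_on (integrableOn_const hμs) hcos hs h
    _ = (∫ y in s, Complex.exp (Complex.I * (θ y : ℂ)) ∂μ).re := by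
        simpa only [RCLike.re_to_complex, hre] using! integral_re hint
    _ ≤ _ := Complex.re_le_norm _

/-- With `g = 1_Ω`, for every `x ∈ Λ` one has `|Eg(x)| ≥ cos(1/100)·|Ω|`. -/
theorem stmt5 (n k : ℕ) (hn : 1 ≤ n) (hk2 : 2 ≤ k) (hk : k ≤ n + 1)
    (κ : ℝ) (hκ0 : 0 < κ) (hκ : κ < 1 / 2) (R : ℝ) (hR : 1 ≤ R)
    (x : EuclideanSpace ℝ (Fin (n + 1))) (hx : x ∈ Lambda n k κ R) :
    Real.cos (1 / 100) * (volume (Omega n k κ R)).toReal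
      ≤ ‖extOp n ((Omega n k κ R).indicator fun _ => (1 : ℂ)) x‖ := by
  have hsub : Omega n k κ R ⊆ ball 0 1 := Set.inter_subset_right
  have hmeas : MeasurableSet (Omega n k κ R) := (isOpen_Omega n k κ R).measurableSet
  have hfin : volume (Omega n k κ R) ≠ ⊤ := measure_ne_top_of_subset hsub measure_ball_lt_top.ne
  have hext : extOp n ((Omega n k κ R).indicator fun _ => (1 : ℂ)) x =
      ∫ ξ in Omega n k κ R, Complex.exp (Complex.I *
        (((∑ i, x i.castSucc * ξ i) + x (Fin.last n) * ‖ξ‖ ^ 2 : ℝ) : ℂ)) := by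
    rw [extOp, ← Set.inter_eq_self_of_subset_right hsub, ← setIntegral_indicator hmeas,
      Set.inter_eq_self_of_subset_right hsub]
    congr 1 with ξ
    by_cases h : ξ ∈ Omega n k κ R <;> simp [h]
  rw [hext]
  refine mul_measureReal_le_norm_setIntegral_exp hmeas hfin (by fun_prop) fun ξ hξ => ?_
  obtain ⟨m, hm⟩ := exists_int_abs_phase_sub_le hk2 hR hx hξ
  exact Real.cos_le_cos_of_abs_sub_int_mul_two_pi_le (by linarith [Real.pi_gt_three]) hm
end

section
/- Let κ = 1/(2(k+1)). There exists a constant C = C(n, k) such that for every x ∈ ℝ^{n+1} and every radius 1 ≤ r ≤ R^{1/2}, the Lebesgue measure of B(x, r) ∩ Λ is at most C · r^n. Consequently the weight H = 1_Λ is n-dimensional up to scale √R with constant C. -/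
open MeasureTheory Metric

/-- The part of an interval of radius `r` within distance `1/1000` of the lattice `Lℤ` has measure
at most `2 r ^ e`, as soon as the spacing satisfies `r ^ (1 - e) ≤ 7 L`. -/
lemma volume_interval_inter_lattice_le {x r e L : ℝ} (hr : 1 ≤ r) (he : 0 ≤ e) (hL : 0 < L)
    (hLr : r ^ (1 - e) ≤ 7 * L) :
    volume {t : ℝ | |t - x| < r ∧ ∃ j : ℤ, |t - L * j| < 1 / 1000} ≤
      ENNReal.ofReal (2 * r ^ e) := by
  set N : Finset ℤ := Finset.Icc ⌈(x - 2 * r) / L⌉ ⌊(x + 2 * r) / L⌋ with hN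
  have hcover : {t : ℝ | |t - x| < r ∧ ∃ j : ℤ, |t - L * j| < 1 / 1000} ⊆
      ⋃ j ∈ N, ball (L * (j : ℝ)) (1 / 1000) := by
    rintro t ⟨ht, j, hj⟩
    have hj' := abs_lt.1 hj
    rw [abs_lt] at ht
    refine Set.mem_biUnion (x := j) ?_ (by rwa [mem_ball, Real.dist_eq])
    rw [hN, Finset.coe_Icc, Set.mem_Icc, Int.ceil_le, Int.le_floor, div_le_iff₀ hL, le_div_iff₀ hL]
    constructor <;> nlinarith
  have hre : 1 ≤ r ^ e := Real.one_le_rpow hr he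
  have hcard : (N.card : ℝ) ≤ 4 * (r / L) + 1 := by
    have hle : (x - 2 * r) / L ≤ (x + 2 * r) / L := by gcongr; linarith
    have hsub : (x + 2 * r) / L - (x - 2 * r) / L = 4 * (r / L) := by ring
    rw [hN, Int.card_Icc]
    have h1 := Int.floor_le ((x + 2 * r) / L)
    have h2 := Int.le_ceil ((x - 2 * r) / L)
    have h0 : 0 ≤ r / L := by positivity
    rcases le_total 0 (⌊(x + 2 * r) / L⌋ + 1 - ⌈(x - 2 * r) / L⌉) with h | h
    · rw [← Int.cast_natCast, Int.toNat_of_nonneg h]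
      push_cast
      linarith
    · rw [Int.toNat_of_nonpos h]
      push_cast
      linarith
  have hrL : r / L ≤ 7 * r ^ e := by
    rw [div_le_iff₀ hL]
    have hprod : r ^ e * r ^ (1 - e) = r := by
      rw [← Real.rpow_add (by linarith)]
      simp
    nlinarith
  calc volume {t : ℝ | |t - x| < r ∧ ∃ j : ℤ, |t - L * j| < 1 / 1000}
      ≤ ∑ j ∈ N, volume (ball (L * (j : ℝ)) (1 / 1000)) :=
        (measure_mono hcover).trans (measure_biUnion_finset_le _ _)
    _ = ENNReal.ofReal (N.card * (2 * (1 / 1000))) := by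
        simp only [Real.volume_ball, Finset.sum_const, nsmul_eq_mul]
        rw [ENNReal.ofReal_mul (Nat.cast_nonneg N.card), ENNReal.ofReal_natCast]
    _ ≤ ENNReal.ofReal (2 * r ^ e) := ENNReal.ofReal_le_ofReal (by linarith)

/-- A set in Euclidean space whose coordinate projections lie in sets of measure at most
`ofReal (b i)` has measure at most `∏ i, b i`. -/
lemma toReal_volume_le_prod {ι : Type*} [Fintype ι] {A : Set (EuclideanSpace ℝ ι)}
    (S : ι → Set ℝ) (b : ι → ℝ) (hb : ∀ i, 0 ≤ b i) (hA : ∀ y ∈ A, ∀ i, y i ∈ S i)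
    (hS : ∀ i, volume (S i) ≤ ENNReal.ofReal (b i)) :
    (volume A).toReal ≤ ∏ i, b i := by
  refine ENNReal.toReal_le_of_le_ofReal (Finset.prod_nonneg fun i _ => hb i) ?_
  calc volume A
      ≤ volume ((MeasurableEquiv.toLp 2 (ι → ℝ)).symm ⁻¹' Set.univ.pi S) :=
        measure_mono fun y hy i _ => hA y hy i
    _ = ∏ i, volume (S i) := by
        rw [(EuclideanSpace.volume_preserving_symm_measurableEquiv_toLp ι).measure_preimage_equiv, volume_pi_pi]
    _ ≤ ∏ i, ENNReal.ofReal (b i) := Finset.prod_le_prod' fun i _ => hS i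
    _ = ENNReal.ofReal (∏ i, b i) := (ENNReal.ofReal_prod_of_nonneg fun i _ => hb i).symm

/-- The growth exponent of the `i`-th coordinate projection of `Λ`. -/
noncomputable def coordExponent (n k i : ℕ) : ℝ :=
  if i < n + 1 - k then 1 else if i < n then k / (k + 1) else (k - 1) / (k + 1)

lemma coordExponent_nonneg {n k : ℕ} (hk : 1 ≤ k) (i : ℕ) : 0 ≤ coordExponent n k i := by
  have : (1 : ℝ) ≤ k := by exact_mod_cast hk
  unfold coordExponent
  split_ifs
  · exact zero_le_one
  · positivity
  · exact div_nonneg (by linarith) (by linarith)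

lemma sum_coordExponent {n k : ℕ} (hk1 : 1 ≤ k) (hk : k ≤ n + 1) :
    ∑ i : Fin (n + 1), coordExponent n k i = n := by
  obtain ⟨j, rfl⟩ : ∃ j, k = j + 1 := ⟨k - 1, by omega⟩
  obtain ⟨m, rfl⟩ : ∃ m, n = m + j := ⟨n - j, by omega⟩
  have hsub : m + j + 1 - (j + 1) = m := by omega
  rw [Fin.sum_univ_eq_sum_range (coordExponent (m + j) (j + 1)), Finset.sum_range_succ,
    Finset.sum_range_add]
  have h1 : ∀ i ∈ Finset.range m, coordExponent (m + j) (j + 1) i = 1 := fun i hi => by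
    simp [coordExponent, hsub, Finset.mem_range.1 hi]
  have h2 : ∀ i ∈ Finset.range j,
      coordExponent (m + j) (j + 1) (m + i) = ((j + 1 : ℕ) : ℝ) / ((j + 1 : ℕ) + 1) :=
    fun i hi => by simp [coordExponent, hsub, Finset.mem_range.1 hi]
  have h3 : coordExponent (m + j) (j + 1) (m + j) =
      (((j + 1 : ℕ) : ℝ) - 1) / ((j + 1 : ℕ) + 1) := by
    simp [coordExponent, hsub]
  rw [Finset.sum_congr rfl h1, Finset.sum_congr rfl h2, h3]
  simp only [Finset.sum_const, Finset.card_range, nsmul_eq_mul]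
  push_cast
  field_simp
  ring

lemma rpow_le_rpow_of_le_sqrt {r R s : ℝ} (hr : 0 ≤ r) (hR : 0 ≤ R) (hs : 0 ≤ s)
    (h : r ≤ √R) : r ^ (2 * s) ≤ R ^ s := by
  rw [Real.rpow_mul hr, Real.rpow_two]
  refine Real.rpow_le_rpow (by positivity) ?_ hs
  exact (Real.le_sqrt hr hR).1 h

/-- The `i`-th coordinate projection of `B(x, r) ∩ Λ` is contained in this set. -/
def coordSet (n k : ℕ) (κ R x r : ℝ) (i : ℕ) : Set ℝ :=
  if i < n + 1 - k then ball x r else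
    {t | |t - x| < r ∧
      ∃ j : ℤ, |t - (if i < n then R ^ κ else 1 / (2 * Real.pi) * R ^ (2 * κ)) * j| < 1 / 1000}

lemma mem_coordSet {n k : ℕ} {κ R r : ℝ} {x y : EuclideanSpace ℝ (Fin (n + 1))}
    (hy : y ∈ ball x r ∩ Lambda n k κ R) (i : Fin (n + 1)) :
    y i ∈ coordSet n k κ R (x i) r i := by
  obtain ⟨hyx, ⟨-, ⟨a, -, ha⟩, j, hj⟩, -⟩ := hy
  have hi : |y i - x i| < r := by
    rw [mem_ball, dist_eq_norm] at hyx
    exact (PiLp.norm_apply_le (y - x) i).trans_lt hyx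
  unfold coordSet
  split_ifs with h1 h2
  · rwa [mem_ball, Real.dist_eq]
  · refine ⟨hi, a i, abs_lt_of_sq_lt_sq (lt_of_le_of_lt ?_ ha) (by norm_num)⟩
    have := Finset.single_le_sum (f := fun i : Fin (n + 1) =>
      if n + 1 - k ≤ (i : ℕ) ∧ (i : ℕ) < n then (y i - R ^ κ * a i) ^ 2 else 0)
      (fun i _ => by split_ifs <;> positivity) (Finset.mem_univ i)
    simpa only [not_lt.1 h1, h2, and_self, if_true] using this
  · obtain rfl : i = Fin.last n := Fin.ext (by simp; omega)
    exact ⟨hi, j, hj⟩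

lemma volume_coordSet_le {n k : ℕ} (hk : 1 ≤ k) {R r : ℝ} (hR : 1 ≤ R) (hr : 1 ≤ r)
    (hrR : r ≤ √R) (x : ℝ) (i : ℕ) :
    volume (coordSet n k (1 / (2 * ((k : ℝ) + 1))) R x r i) ≤
      ENNReal.ofReal (2 * r ^ coordExponent n k i) := by
  have hR0 : 0 < R := by linarith
  have he := coordExponent_nonneg (n := n) hk i
  unfold coordSet coordExponent at *
  split_ifs at * with h1 h2
  · rw [Real.volume_ball, Real.rpow_one]
  · have h := rpow_le_rpow_of_le_sqrt (s := 1 / (2 * ((k : ℝ) + 1))) (by linarith) hR0.le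
      (by positivity) hrR
    have h0 : 0 < R ^ (1 / (2 * ((k : ℝ) + 1))) := by positivity
    refine volume_interval_inter_lattice_le hr he h0 ?_
    rw [show 1 - (k : ℝ) / (k + 1) = 2 * (1 / (2 * ((k : ℝ) + 1))) by field_simp; ring]
    linarith
  · have h := rpow_le_rpow_of_le_sqrt (s := 2 * (1 / (2 * ((k : ℝ) + 1)))) (by linarith) hR0.le
      (by positivity) hrR
    have h0 : 0 < R ^ (2 * (1 / (2 * ((k : ℝ) + 1)))) := by positivity
    refine volume_interval_inter_lattice_le hr he (by positivity) ?_
    rw [show 1 - ((k : ℝ) - 1) / (k + 1) = 2 * (2 * (1 / (2 * ((k : ℝ) + 1)))) by field_simp; ring]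
    refine h.trans ?_
    have hpi : 1 ≤ 7 * (1 / (2 * Real.pi)) := by
      rw [mul_one_div, le_div_iff₀ (by positivity)]
      linarith [Real.pi_lt_d2]
    rw [← mul_assoc]
    exact le_mul_of_one_le_left h0.le hpi

/-- With `κ = 1/(2(k+1))`, there is `C = C(n,k)` such that for every `x ∈ ℝ^{n+1}` and every
`1 ≤ r ≤ R^{1/2}`, `|B(x,r) ∩ Λ| ≤ C·rⁿ`; i.e. `H = 1_Λ` is `n`-dimensional up to scale `√R`
with constant `C`. -/
theorem stmt6 (n k : ℕ) (hn : 1 ≤ n) (hk2 : 2 ≤ k) (hk : k ≤ n + 1) :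
    ∃ C : ℝ, 0 < C ∧ ∀ R : ℝ, 1 ≤ R →
      ∀ (x : EuclideanSpace ℝ (Fin (n + 1))) (r : ℝ), 1 ≤ r → r ≤ Real.sqrt R →
        (volume (ball x r ∩ Lambda n k (1 / (2 * ((k : ℝ) + 1))) R)).toReal
          ≤ C * r ^ (n : ℝ) := by
  refine ⟨2 ^ (n + 1), by positivity, fun R hR x r hr hrR => ?_⟩
  have hk1 : 1 ≤ k := by omega
  refine (toReal_volume_le_prod (fun i => coordSet n k (1 / (2 * ((k : ℝ) + 1))) R (x i) r i)
    (fun i => 2 * r ^ coordExponent n k i) (fun i => by positivity)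
    (fun y hy i => mem_coordSet hy i)
    (fun i => volume_coordSet_le hk1 hR hr hrR (x i) i)).trans_eq ?_
  rw [Finset.prod_mul_distrib, ← Real.rpow_sum_of_pos (by linarith), sum_coordExponent hk1 hk]
  simp
end

section
/- Let κ = 1/(2(k+1)) and suppose in addition that k ≤ n. Then there exists a constant C = C(n, k) such that for every x ∈ ℝ^{n+1} and every radius 1 ≤ r ≤ R, the Lebesgue measure of B(x, r) ∩ Λ is at most C · r^n; that is, the weight H = 1_Λ is n-dimensional up to scale R with constant C. -/
open MeasureTheory Metric

/-- An interval of half-length `r` meets the `1/1000`-neighbourhood of the lattice `L ℤ` in a set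
of measure at most `(1 + 4 r / L) / 500`. -/
theorem volume_interval_inter_lattice_nhds_le (y r L : ℝ) (hr : 1 ≤ r) (hL : 0 < L) :
    volume {t : ℝ | |t - y| < r ∧ ∃ a : ℤ, |t - L * a| < 1 / 1000} ≤
      ENNReal.ofReal ((1 + 4 * (r / L)) / 500) := by
  set lo : ℤ := ⌈(y - 2 * r) / L⌉
  set hi : ℤ := ⌊(y + 2 * r) / L⌋
  have hsub : {t : ℝ | |t - y| < r ∧ ∃ a : ℤ, |t - L * a| < 1 / 1000} ⊆
      ⋃ a ∈ Finset.Icc lo hi, ball (L * (a : ℝ)) (1 / 1000) := by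
    rintro t ⟨hty, a, ha⟩
    simp only [Set.mem_iUnion, Finset.mem_Icc, mem_ball, Real.dist_eq]
    refine ⟨a, ⟨?_, ?_⟩, ha⟩
    · rw [Int.ceil_le, div_le_iff₀ hL]
      rw [abs_lt] at hty ha
      linarith
    · rw [Int.le_floor, le_div_iff₀ hL]
      rw [abs_lt] at hty ha
      linarith
  have hcard : ((Finset.Icc lo hi).card : ℝ) ≤ 1 + 4 * (r / L) := by
    have h1 : (hi : ℝ) ≤ (y + 2 * r) / L := Int.floor_le _
    have h2 : (y - 2 * r) / L ≤ lo := Int.le_ceil _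
    have h3 : (y + 2 * r) / L - (y - 2 * r) / L = 4 * (r / L) := by ring
    have h4 : 0 ≤ r / L := by positivity
    rw [Int.card_Icc]
    rcases le_total 0 (hi + 1 - lo) with h | h
    · have h5 : (((hi + 1 - lo).toNat : ℤ) : ℝ) = ((hi + 1 - lo : ℤ) : ℝ) := by
        rw [Int.toNat_of_nonneg h]
      push_cast at h5
      linarith
    · rw [Int.toNat_of_nonpos h]
      push_cast
      linarith
  calc _ ≤ volume (⋃ a ∈ Finset.Icc lo hi, ball (L * (a : ℝ)) (1 / 1000)) := measure_mono hsub
    _ ≤ ∑ a ∈ Finset.Icc lo hi, volume (ball (L * (a : ℝ)) (1 / 1000)) :=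
        measure_biUnion_finset_le _ _
    _ = ENNReal.ofReal ((Finset.Icc lo hi).card * (1 / 500)) := by
        simp only [Real.volume_ball, Finset.sum_const, nsmul_eq_mul]
        rw [ENNReal.ofReal_mul (Nat.cast_nonneg _), ENNReal.ofReal_natCast]
        norm_num
    _ ≤ _ := by
        apply ENNReal.ofReal_le_ofReal
        linarith

/-- The symmetric interval `(-s, s)` meets an interval of half-length `r` in a set of measure at
most `2 min r s`. -/
theorem volume_interval_inter_centered_le (y r s : ℝ) :
    volume {t : ℝ | |t - y| < r ∧ |t| < s} ≤ ENNReal.ofReal (2 * min r s) := by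
  have h1 : volume {t : ℝ | |t - y| < r ∧ |t| < s} ≤ volume (ball y r) :=
    measure_mono fun t ht => by simpa [Real.dist_eq] using ht.1
  have h2 : volume {t : ℝ | |t - y| < r ∧ |t| < s} ≤ volume (ball (0 : ℝ) s) :=
    measure_mono fun t ht => by simpa [Real.dist_eq] using ht.2
  rw [Real.volume_ball] at h1 h2
  rcases min_choice r s with h | h <;> rw [h] <;> assumption

/-- A set contained in a coordinate box of `EuclideanSpace` has volume at most the product of the
side volumes. -/
theorem EuclideanSpace.volume_le_prod_of_forall_mem {ι : Type*} [Fintype ι]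
    (A : Set (EuclideanSpace ℝ ι)) (S : ι → Set ℝ) (h : ∀ z ∈ A, ∀ i, z i ∈ S i) :
    volume A ≤ ∏ i, volume (S i) := by
  rw [← volume_pi_pi,
    ← (EuclideanSpace.volume_preserving_symm_measurableEquiv_toLp ι).measure_preimage_equiv]
  exact measure_mono fun z hz i _ => h z hz i

/-- The elementary inequality comparing the product of the side measures with a power of `r`. -/
theorem min_pow_mul_one_add_div_pow_mul_le (q p : ℕ) (a r : ℝ) (ha : 1 ≤ a) (hr : 1 ≤ r) :
    (2 * min r (a ^ (p + 3))) ^ (q + 1) * (1 + r / a) ^ (p + 1) * (1 + r / a ^ 2) ≤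
      2 ^ (q + p + 3) * r ^ (q + p + 2) := by
  have ha0 : 0 < a := by linarith
  have hr0 : 0 < r := by linarith
  have hs0 : 0 < min r (a ^ (p + 3)) := lt_min hr0 (by positivity)
  rcases le_total r (a ^ 2) with h | h
  · have hA : 1 + r / a ≤ 2 * r := by
      have : r / a ≤ r := div_le_self hr0.le ha
      linarith
    have hB : 1 + r / a ^ 2 ≤ 2 := by
      have : r / a ^ 2 ≤ 1 := div_le_one_of_le₀ h (by positivity)
      linarith
    calc _ ≤ (2 * r) ^ (q + 1) * (2 * r) ^ (p + 1) * 2 := by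
          gcongr
          exact min_le_left _ _
      _ = _ := by ring
  · have hA : 1 + r / a ≤ 2 * (r / a) := by
      have : 1 ≤ r / a := by
        rw [le_div_iff₀ ha0]
        nlinarith
      linarith
    have hB : 1 + r / a ^ 2 ≤ 2 * (r / a ^ 2) := by
      have : 1 ≤ r / a ^ 2 := by
        rw [le_div_iff₀ (by positivity)]
        linarith
      linarith
    calc _ = (2 * min r (a ^ (p + 3))) ^ q * (2 * min r (a ^ (p + 3))) * (1 + r / a) ^ (p + 1) *
            (1 + r / a ^ 2) := by rw [pow_succ]
      _ ≤ (2 * r) ^ q * (2 * a ^ (p + 3)) * (2 * (r / a)) ^ (p + 1) * (2 * (r / a ^ 2)) := by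
          gcongr
          · exact min_le_left _ _
          · exact min_le_right _ _
      _ = _ := by
          simp only [mul_pow, div_pow]
          field_simp
          ring

/-- A point of `Lambda` has each of its coordinates in the corresponding one-dimensional set. -/
theorem coord_of_mem_Lambda {n k : ℕ} {κ R : ℝ} (hR : 1 ≤ R)
    {z : EuclideanSpace ℝ (Fin (n + 1))} (hz : z ∈ Lambda n k κ R) :
    (∀ i : Fin (n + 1), (i : ℕ) < n + 1 - k → |z i| < R ^ ((1 : ℝ) / 2)) ∧
    (∀ i : Fin (n + 1), n + 1 - k ≤ (i : ℕ) → (i : ℕ) < n →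
      ∃ a : ℤ, |z i - R ^ κ * a| < 1 / 1000) := by
  obtain ⟨⟨h1, ⟨a, -, h2⟩, -⟩, -⟩ := hz
  refine ⟨fun i hi => ?_, fun i hi hi' => ⟨a i, ?_⟩⟩
  · have h3 := Finset.single_le_sum
      (f := fun i : Fin (n + 1) => if (i : ℕ) < n + 1 - k then z i ^ 2 else 0)
      (fun j _ => by dsimp only; split_ifs <;> positivity) (Finset.mem_univ i)
    simp only [hi, if_true] at h3
    have h4 : 0 < R ^ ((1 : ℝ) / 2) := by positivity
    have h5 := abs_lt_of_sq_lt_sq (h3.trans_lt h1) (by positivity)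
    linarith
  · have h3 := Finset.single_le_sum
      (f := fun i : Fin (n + 1) => if n + 1 - k ≤ (i : ℕ) ∧ (i : ℕ) < n
        then (z i - R ^ κ * a i) ^ 2 else 0)
      (fun j _ => by dsimp only; split_ifs <;> positivity) (Finset.mem_univ i)
    simp only [hi, hi', and_self, if_true] at h3
    exact abs_lt_of_sq_lt_sq (h3.trans_lt h2) (by positivity)

/-- With `κ = 1/(2(k+1))`, there is `C = C(n,k)` such that for every `x ∈ ℝ^{n+1}` and every
`1 ≤ r ≤ R`, `|B(x,r) ∩ Λ| ≤ C·rⁿ`; i.e. `H = 1_Λ` is `n`-dimensional up to scale `R`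
with constant `C`. -/
theorem stmt7 (n k : ℕ) (hn : 1 ≤ n) (hk2 : 2 ≤ k) (hk : k ≤ n) :
    ∃ C : ℝ, 0 < C ∧ ∀ R : ℝ, 1 ≤ R →
      ∀ (x : EuclideanSpace ℝ (Fin (n + 1))) (r : ℝ), 1 ≤ r → r ≤ R →
        (volume (ball x r ∩ Lambda n k (1 / (2 * ((k : ℝ) + 1))) R)).toReal
          ≤ C * r ^ (n : ℝ) := by
  refine ⟨2 ^ (n + 1), by positivity, fun R hR x r hr _ => ?_⟩
  obtain ⟨p, rfl⟩ := Nat.exists_eq_add_of_le' hk2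
  obtain ⟨q, rfl⟩ := Nat.exists_eq_add_of_le' hk
  have hR0 : 0 < R := by linarith
  set κ : ℝ := 1 / (2 * (((p + 2 : ℕ) : ℝ) + 1)) with hκ
  have hκ0 : 0 < κ := by positivity
  have ha : 1 ≤ R ^ κ := Real.one_le_rpow hR hκ0.le
  have ha2 : R ^ (2 * κ) = (R ^ κ) ^ 2 := by
    rw [← Real.rpow_natCast, ← Real.rpow_mul hR0.le]
    congr 1
    push_cast
    ring
  have has : R ^ ((1 : ℝ) / 2) = (R ^ κ) ^ (p + 3) := by
    rw [← Real.rpow_natCast, ← Real.rpow_mul hR0.le]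
    congr 1
    rw [hκ]
    push_cast
    field_simp
    ring
  set a := R ^ κ with ha_def
  have ha0 : 0 < a := by linarith
  let S : Fin (q + (p + 2) + 1) → Set ℝ := fun i =>
    if (i : ℕ) < q + 1 then {t | |t - x i| < r ∧ |t| < a ^ (p + 3)}
    else if (i : ℕ) < q + (p + 2) then {t | |t - x i| < r ∧ ∃ b : ℤ, |t - a * b| < 1 / 1000}
    else {t | |t - x i| < r ∧ ∃ b : ℤ, |t - 1 / (2 * Real.pi) * a ^ 2 * b| < 1 / 1000}
  let f : ℕ → ℝ := fun i =>
    if i < q + 1 then 2 * min r (a ^ (p + 3))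
    else if i < q + (p + 2) then 1 + r / a else 1 + r / a ^ 2
  have hf0 : ∀ i, 0 ≤ f i := fun i => by
    dsimp only [f]
    split_ifs <;> positivity
  have hbox : volume (ball x r ∩ Lambda (q + (p + 2)) (p + 2) κ R) ≤ ∏ i, volume (S i) := by
    refine EuclideanSpace.volume_le_prod_of_forall_mem _ _ fun z hz i => ?_
    have hzi : |z i - x i| < r := by
      have h1 : dist z x < r := hz.1
      rw [dist_eq_norm] at h1
      exact (PiLp.norm_apply_le (z - x) i).trans_lt h1
    obtain ⟨hc1, hc2⟩ := coord_of_mem_Lambda hR hz.2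
    dsimp only [S]
    split_ifs with h1 h2
    · exact ⟨hzi, has ▸ hc1 i (by omega)⟩
    · exact ⟨hzi, hc2 i (by omega) h2⟩
    · refine ⟨hzi, ?_⟩
      have hi : i = Fin.last _ := Fin.ext (by have := i.2; simp only [Fin.val_last]; omega)
      have h3 := hz.2.1.2.2
      rw [ha2] at h3
      rw [hi]
      exact h3
  have hS : ∀ i, volume (S i) ≤ ENNReal.ofReal (f i) := fun i => by
    have hra : 0 ≤ r / a := by positivity
    have hra2 : 0 ≤ r / a ^ 2 := by positivity
    dsimp only [S, f]
    split_ifs with h1 h2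
    · exact volume_interval_inter_centered_le _ _ _
    · refine (volume_interval_inter_lattice_nhds_le _ _ _ hr ha0).trans
        (ENNReal.ofReal_le_ofReal ?_)
      linarith
    · refine (volume_interval_inter_lattice_nhds_le _ _ _ hr (by positivity)).trans
        (ENNReal.ofReal_le_ofReal ?_)
      have h3 : r / (1 / (2 * Real.pi) * a ^ 2) = 2 * Real.pi * (r / a ^ 2) := by
        field_simp
      rw [h3]
      nlinarith [Real.pi_lt_four]
  have hprod : ∏ i : Fin (q + (p + 2) + 1), f i =
      (2 * min r (a ^ (p + 3))) ^ (q + 1) * (1 + r / a) ^ (p + 1) * (1 + r / a ^ 2) := by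
    rw [Fin.prod_univ_eq_prod_range f, Finset.prod_range_succ,
      show q + (p + 2) = (q + 1) + (p + 1) by ring, Finset.prod_range_add]
    congr 1
    · congr 1
      · rw [Finset.prod_congr rfl (g := fun _ => 2 * min r (a ^ (p + 3)))]
        · simp
        · intro i hi
          exact if_pos (Finset.mem_range.1 hi)
      · rw [Finset.prod_congr rfl (g := fun _ => 1 + r / a)]
        · simp
        · intro i hi
          have := Finset.mem_range.1 hi
          dsimp only [f]
          rw [if_neg (by omega), if_pos (by omega)]
    · dsimp only [f]
      rw [if_neg (by omega), if_neg (by omega)]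
  refine ENNReal.toReal_le_of_le_ofReal (by positivity) ?_
  calc _ ≤ ∏ i, volume (S i) := hbox
    _ ≤ ∏ i : Fin (q + (p + 2) + 1), ENNReal.ofReal (f i) := Finset.prod_le_prod' fun i _ => hS i
    _ = ENNReal.ofReal (∏ i : Fin (q + (p + 2) + 1), f i) :=
        (ENNReal.ofReal_prod_of_nonneg fun (i : Fin (q + (p + 2) + 1)) _ => hf0 i).symm
    _ ≤ _ := by
        apply ENNReal.ofReal_le_ofReal
        rw [hprod, Real.rpow_natCast]
        exact min_pow_mul_one_add_div_pow_mul_le q p a r ha hr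
end
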